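/- The vector x ∈ ℝ^d is the Σ-expectile e_α^Σ(X) if and only if for every k ∈ {1,…,d}: α·Σ_{i=1}^d π_{ki} E[(X_i−x_i)₊·1_{{X_k>x_k}}] = (1−α)·Σ_{i=1}^d π_{ki} E[(x_i−X_i)₊·1_{{X_k<x_k}}], provided X has continuous marginal distributions. -/

import Mathlib

open MeasureTheory Matrix

lemma quadForm_eq_add {d : ℕ} {S : Matrix (Fin d) (Fin d) ℝ} (hS : S.IsHermitian)
    (a b : Fin d → ℝ) :
    b ⬝ᵥ S.mulVec b
      = a ⬝ᵥ S.mulVec a + 2 * (S.mulVec a ⬝ᵥ (b - a)) + (b - a) ⬝ᵥ S.mulVec (b - a) := by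
  have hT : Sᵀ = S := by simpa [Matrix.IsHermitian] using hS
  have hsymm : a ⬝ᵥ S.mulVec b = S.mulVec a ⬝ᵥ b := by
    rw [dotProduct_mulVec, ← mulVec_transpose, hT]
  simp only [mulVec_sub, dotProduct_sub, sub_dotProduct]
  rw [hsymm, dotProduct_comm b (S.mulVec a), dotProduct_comm a (S.mulVec a)]
  ring

lemma mulVec_nonneg_of_nonneg {d : ℕ} {S : Matrix (Fin d) (Fin d) ℝ} (hpos : ∀ i j, 0 < S i j)
    {a : Fin d → ℝ} (ha : ∀ i, 0 ≤ a i) (k : Fin d) : 0 ≤ S.mulVec a k := by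
  unfold Matrix.mulVec dotProduct
  exact Finset.sum_nonneg fun i _ => mul_nonneg (hpos k i).le (ha i)

/-- Subgradient inequality for the quadratic form along componentwise lower bounds. -/
lemma quadForm_add_le {d : ℕ} {S : Matrix (Fin d) (Fin d) ℝ} (hS : S.PosDef)
    (hpos : ∀ i j, 0 < S i j) {a b c : Fin d → ℝ} (ha : ∀ i, 0 ≤ a i)
    (hc : ∀ i, c i ≤ b i - a i) :
    a ⬝ᵥ S.mulVec a + 2 * ∑ k, S.mulVec a k * c k ≤ b ⬝ᵥ S.mulVec b := by
  have h1 := quadForm_eq_add hS.1 a b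
  have h2 : 0 ≤ (b - a) ⬝ᵥ S.mulVec (b - a) := by
    simpa using hS.posSemidef.dotProduct_mulVec_nonneg (b - a)
  have h3 : ∑ k, S.mulVec a k * c k ≤ S.mulVec a ⬝ᵥ (b - a) :=
    Finset.sum_le_sum fun k _ =>
      mul_le_mul_of_nonneg_left (hc k) (mulVec_nonneg_of_nonneg hpos ha k)
  linarith

lemma quadForm_le_of_sub_eq_single {d : ℕ} {S : Matrix (Fin d) (Fin d) ℝ} (hS : S.PosDef)
    (hpos : ∀ i j, 0 < S i j) {a b : Fin d → ℝ} {k : Fin d} {r t : ℝ}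
    (hb : b - a = Pi.single k r) (hr : |r| ≤ |t|) :
    b ⬝ᵥ S.mulVec b ≤ a ⬝ᵥ S.mulVec a + 2 * (S.mulVec a k * r) + S k k * t ^ 2 := by
  rw [quadForm_eq_add hS.1 a b, hb, dotProduct_single, single_dotProduct, mulVec_single]
  have h := mul_le_mul_of_nonneg_left (sq_le_sq.mpr hr) (hpos k k).le
  simp
  nlinarith

lemma integrable_dotProduct_mulVec {Ω : Type*} [MeasurableSpace Ω] {μ : Measure Ω} {d : ℕ}
    (S : Matrix (Fin d) (Fin d) ℝ) {V : Ω → Fin d → ℝ} (hV : ∀ i, MemLp (fun ω => V ω i) 2 μ) :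
    Integrable (fun ω => V ω ⬝ᵥ S.mulVec (V ω)) μ := by
  unfold dotProduct Matrix.mulVec dotProduct
  refine integrable_finsetSum _ fun i _ => ?_
  refine (hV i).integrable_mul (q := 2) (memLp_finsetSum _ fun j _ => ?_)
  exact (hV j).const_mul _

lemma integrable_mulVec {Ω : Type*} [MeasurableSpace Ω] {μ : Measure Ω} {d : ℕ}
    (S : Matrix (Fin d) (Fin d) ℝ) {V : Ω → Fin d → ℝ} (hV : ∀ i, Integrable (fun ω => V ω i) μ)
    (k : Fin d) : Integrable (fun ω => S.mulVec (V ω) k) μ := by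
  unfold Matrix.mulVec dotProduct
  exact integrable_finsetSum _ fun i _ => (hV i).const_mul _

lemma integral_mulVec_mul_indicator {Ω : Type*} [MeasurableSpace Ω] {μ : Measure Ω} {d : ℕ}
    (S : Matrix (Fin d) (Fin d) ℝ) {V : Ω → Fin d → ℝ} (hV : ∀ i, Integrable (fun ω => V ω i) μ)
    {p : Ω → Prop} [DecidablePred p] (hp : MeasurableSet {ω | p ω}) (k : Fin d) :
    ∫ ω, S.mulVec (V ω) k * (if p ω then 1 else 0) ∂μ
      = ∑ i, S k i * ∫ ω, (if p ω then V ω i else 0) ∂μ := by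
  have h (i : Fin d) : Integrable (fun ω => if p ω then V ω i else 0) μ := by
    refine ((hV i).indicator hp).congr (Filter.Eventually.of_forall fun ω => ?_)
    simp [Set.indicator_apply]
  simp_rw [← integral_const_mul]
  rw [← integral_finsetSum _ fun i _ => (h i).const_mul _]
  refine integral_congr_ae (Filter.Eventually.of_forall fun ω => ?_)
  by_cases hω : p ω <;> simp [hω, Matrix.mulVec, dotProduct]

lemma integrable_mul_indicator {Ω : Type*} [MeasurableSpace Ω] {μ : Measure Ω} {A : Ω → ℝ}
    (hA : Integrable A μ) {p : Ω → Prop} [DecidablePred p] (hp : MeasurableSet {ω | p ω}) :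
    Integrable (fun ω => A ω * (if p ω then 1 else 0)) μ := by
  refine (hA.indicator hp).congr (Filter.Eventually.of_forall fun ω => ?_)
  simp [Set.indicator_apply]

lemma abs_max_add_sub_max_le (z u v : ℝ) : |max (z + u) 0 - max (z + v) 0| ≤ |u - v| := by
  simpa using abs_max_sub_max_le_abs (z + u) (z + v) 0

lemma integrable_mul_max_sub_max {Ω : Type*} [MeasurableSpace Ω] {μ : Measure Ω} {A Z : Ω → ℝ}
    (hA : Integrable A μ) (hZ : Measurable Z) (u : ℝ) :
    Integrable (fun ω => A ω * (max (Z ω + u) 0 - max (Z ω) 0)) μ := by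
  refine hA.mul_bdd (c := |u|) (by fun_prop) (Filter.Eventually.of_forall fun ω => ?_)
  simpa using abs_max_add_sub_max_le (Z ω) u 0

lemma hasDerivAt_integral_mul_max {Ω : Type*} [MeasurableSpace Ω] {μ : Measure Ω} {A Z : Ω → ℝ}
    (hA : Integrable A μ) (hZ : Measurable Z) (hZ0 : ∀ᵐ ω ∂μ, Z ω ≠ 0) (s : ℝ) :
    HasDerivAt (fun t => ∫ ω, A ω * (max (Z ω + s * t) 0 - max (Z ω) 0) ∂μ)
      (∫ ω, A ω * (s * if 0 < Z ω then 1 else 0) ∂μ) 0 := by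
  refine (hasDerivAt_integral_of_dominated_loc_of_lip (bound := fun ω => |A ω| * |s|)
    (s := Set.univ) Filter.univ_mem
    (Filter.Eventually.of_forall fun t =>
      (integrable_mul_max_sub_max hA hZ (s * t)).aestronglyMeasurable)
    (integrable_mul_max_sub_max hA hZ (s * 0)) ?_ ?_ (hA.abs.mul_const _) ?_).2
  · exact hA.aestronglyMeasurable.mul
      (((measurable_const.ite (measurableSet_lt measurable_const hZ)
        measurable_const).const_mul s).aestronglyMeasurable)
  · refine Filter.Eventually.of_forall fun ω => ?_
    refine LipschitzOnWith.of_dist_le_mul fun u _ v _ => ?_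
    rw [Real.dist_eq, Real.dist_eq, ← mul_sub, abs_mul, sub_sub_sub_cancel_right]
    simp only [Real.coe_nnabs, abs_mul, abs_abs]
    rw [mul_assoc, ← abs_mul s, mul_sub]
    exact mul_le_mul_of_nonneg_left (abs_max_add_sub_max_le _ _ _) (abs_nonneg _)
  · filter_upwards [hZ0] with ω hω
    refine HasDerivAt.const_mul (A ω) (HasDerivAt.sub_const _ ?_)
    have hlin : HasDerivAt (fun t => Z ω + s * t) s 0 := by
      simpa using ((hasDerivAt_id (0 : ℝ)).const_mul s).const_add (Z ω)
    have hc : Filter.Tendsto (fun t => Z ω + s * t) (nhds 0) (nhds (Z ω)) := by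
      simpa using hlin.continuousAt.tendsto
    rcases lt_or_gt_of_ne hω with h | h
    · rw [if_neg h.not_gt, mul_zero]
      refine (hasDerivAt_const (0 : ℝ) (0 : ℝ)).congr_of_eventuallyEq ?_
      filter_upwards [hc.eventually_lt_const h] with t ht
      exact max_eq_right ht.le
    · rw [if_pos h, mul_one]
      refine hlin.congr_of_eventuallyEq ?_
      filter_upwards [hc.eventually_const_lt h] with t ht
      exact max_eq_left ht.le

theorem sigma_expectile_first_order_condition
    {Ω : Type*} [MeasurableSpace Ω] (μ : Measure Ω) [IsProbabilityMeasure μ]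
    {d : ℕ} (S : Matrix (Fin d) (Fin d) ℝ) (hS : S.PosDef) (hpos : ∀ i j, 0 < S i j)
    (X : Ω → Fin d → ℝ) (hm : Measurable X)
    (hint : ∀ i j, Integrable (fun ω => |X ω i * X ω j|) μ)
    (hcont : ∀ i (t : ℝ), μ {ω | X ω i = t} = 0)
    (α : ℝ) (hα : α ∈ Set.Ioo (0:ℝ) 1) (x : Fin d → ℝ) :
    IsMinOn
      (fun y : Fin d → ℝ => ∫ ω,
        α * ((fun i => max (X ω i - y i) 0) ⬝ᵥ S.mulVec (fun i => max (X ω i - y i) 0))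
        + (1-α) * ((fun i => max (y i - X ω i) 0) ⬝ᵥ S.mulVec (fun i => max (y i - X ω i) 0)) ∂μ)
      Set.univ x
    ↔ ∀ k, α * ∑ i, S k i * ∫ ω, (if x k < X ω k then max (X ω i - x i) 0 else 0) ∂μ
         = (1-α) * ∑ i, S k i * ∫ ω, (if X ω k < x k then max (x i - X ω i) 0 else 0) ∂μ := by
  obtain ⟨hα0, hα1⟩ := hα
  have hXi (i : Fin d) : Measurable fun ω => X ω i := (measurable_pi_apply i).comp hm
  have hX2 (i : Fin d) : MemLp (fun ω => X ω i) 2 μ := by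
    rw [memLp_two_iff_integrable_sq (hXi i).aestronglyMeasurable]
    refine (hint i i).congr (Filter.Eventually.of_forall fun ω => ?_)
    simp [abs_mul_abs_self, pow_two]
  have hP2 (y : Fin d → ℝ) (i : Fin d) : MemLp (fun ω => max (X ω i - y i) 0) 2 μ :=
    ((hX2 i).sub (memLp_const (y i))).pos_part
  have hN2 (y : Fin d → ℝ) (i : Fin d) : MemLp (fun ω => max (y i - X ω i) 0) 2 μ :=
    ((memLp_const (y i)).sub (hX2 i)).pos_part
  have hP1 (y : Fin d → ℝ) (i : Fin d) := (hP2 y i).integrable one_le_two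
  have hN1 (y : Fin d → ℝ) (i : Fin d) := (hN2 y i).integrable one_le_two
  have hF (y : Fin d → ℝ) :=
    ((integrable_dotProduct_mulVec S (hP2 y)).const_mul α).add
      ((integrable_dotProduct_mulVec S (hN2 y)).const_mul (1 - α))
  have hSP := integrable_mulVec S (hP1 x)
  have hSN := integrable_mulVec S (hN1 x)
  have hmP (k : Fin d) : MeasurableSet {ω | x k < X ω k} :=
    measurableSet_lt measurable_const (hXi k)
  have hmN (k : Fin d) : MeasurableSet {ω | X ω k < x k} :=
    measurableSet_lt (hXi k) measurable_const
  have hIP (k : Fin d) := integral_mulVec_mul_indicator S (hP1 x) (hmP k) k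
  have hIN (k : Fin d) := integral_mulVec_mul_indicator S (hN1 x) (hmN k) k
  simp_rw [← hIP, ← hIN]
  constructor
  · intro hmin k
    have hne : ∀ᵐ ω ∂μ, X ω k ≠ x k := by
      rw [ae_iff]; simpa using hcont k (x k)
    have hZP : Measurable fun ω => X ω k - x k := (hXi k).sub_const _
    have hZN : Measurable fun ω => x k - X ω k := (hXi k).const_sub _
    have hdP := hasDerivAt_integral_mul_max (hSP k) hZP
      (hne.mono fun ω h => sub_ne_zero.mpr h) (-1)
    have hdN := hasDerivAt_integral_mul_max (hSN k) hZN
      (hne.mono fun ω h => sub_ne_zero.mpr h.symm) 1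
    have hd := ((hdP.const_mul (2 * α)).add (hdN.const_mul (2 * (1 - α)))).add
      ((hasDerivAt_pow 2 (0 : ℝ)).const_mul (S k k))
    have hlm := IsLocalMin.hasDerivAt_eq_zero (Filter.Eventually.of_forall fun t => ?_) hd
    · simp only [sub_pos, neg_one_mul, one_mul, mul_neg, integral_neg] at hlm
      norm_num at hlm
      simp only [mul_ite, mul_one, mul_zero]
      linarith
    · have hle := isMinOn_univ_iff.mp hmin (Function.update x k (x k + t))
      have hiP := integrable_mul_max_sub_max (hSP k) hZP (-1 * t)
      have hiN := integrable_mul_max_sub_max (hSN k) hZN (1 * t)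
      have hbound := hle.trans (integral_mono (hF _)
        ((((hF x).add (hiP.const_mul (2 * α))).add (hiN.const_mul (2 * (1 - α)))).add
          (integrable_const (S k k * t ^ 2))) fun ω => ?_)
      · rw [integral_add' (((hF x).add (hiP.const_mul (2 * α))).add
            (hiN.const_mul (2 * (1 - α)))) (integrable_const _),
          integral_add' ((hF x).add (hiP.const_mul (2 * α))) (hiN.const_mul (2 * (1 - α))),
          integral_add' (hF x) (hiP.const_mul (2 * α)), integral_const_mul,
          integral_const_mul] at hbound
        simp at hbound ⊢
        linarith
      · have hp := quadForm_le_of_sub_eq_single hS hpos (k := k) (t := t)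
          (a := fun i => max (X ω i - x i) 0)
          (b := fun i => max (X ω i - Function.update x k (x k + t) i) 0)
          (r := max (X ω k - x k + -1 * t) 0 - max (X ω k - x k) 0)
          (by
            ext i
            by_cases hi : i = k
            · subst hi; simp; ring_nf
            · simp [hi])
          (by simpa using abs_max_add_sub_max_le (X ω k - x k) (-1 * t) 0)
        have hn := quadForm_le_of_sub_eq_single hS hpos (k := k) (t := t)
          (a := fun i => max (x i - X ω i) 0)
          (b := fun i => max (Function.update x k (x k + t) i - X ω i) 0)
          (r := max (x k - X ω k + 1 * t) 0 - max (x k - X ω k) 0)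
          (by
            ext i
            by_cases hi : i = k
            · subst hi; simp; ring_nf
            · simp [hi])
          (by simpa using abs_max_add_sub_max_le (x k - X ω k) (1 * t) 0)
        have hp' := mul_le_mul_of_nonneg_left hp hα0.le
        have hn' := mul_le_mul_of_nonneg_left hn (sub_nonneg.mpr hα1.le)
        simp only [Pi.add_apply]
        linarith
  · intro hfoc
    refine isMinOn_univ_iff.mpr fun y => ?_
    have hiP (k : Fin d) := integrable_mul_indicator (hSP k) (hmP k)
    have hiN (k : Fin d) := integrable_mul_indicator (hSN k) (hmN k)
    have hG (k : Fin d) := (((hiP k).const_mul α).sub ((hiN k).const_mul (1 - α))).const_mul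
      (2 * (x k - y k))
    have hGs := integrable_finsetSum Finset.univ fun k _ => hG k
    have hzero (k : Fin d) := calc
      _ = _ := integral_const_mul (μ := μ) (2 * (x k - y k)) _
      _ = 0 := by
        rw [integral_sub' ((hiP k).const_mul α) ((hiN k).const_mul (1 - α)),
          integral_const_mul, integral_const_mul, hfoc k, sub_self, mul_zero]
    have hbound := integral_mono ((hF x).add hGs) (hF y) fun ω => ?_
    · rw [integral_add' (hF x) hGs, integral_finsetSum _ fun k _ => hG k,
        Finset.sum_eq_zero fun k _ => hzero k, add_zero] at hbound
      exact hbound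
    · have hp := quadForm_add_le hS hpos
        (a := fun i => max (X ω i - x i) 0) (b := fun i => max (X ω i - y i) 0)
        (c := fun k => (x k - y k) * if x k < X ω k then 1 else 0)
        (fun i => le_max_right _ _) (fun i => by
          split_ifs with h
          · rw [max_eq_left (sub_nonneg.mpr h.le)]
            linarith [le_max_left (X ω i - y i) 0]
          · rw [max_eq_right (sub_nonpos.mpr (not_lt.mp h))]
            simp)
      have hn := quadForm_add_le hS hpos
        (a := fun i => max (x i - X ω i) 0) (b := fun i => max (y i - X ω i) 0)
        (c := fun k => (y k - x k) * if X ω k < x k then 1 else 0)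
        (fun i => le_max_right _ _) (fun i => by
          split_ifs with h
          · rw [max_eq_left (sub_nonneg.mpr h.le)]
            linarith [le_max_left (y i - X ω i) 0]
          · rw [max_eq_right (sub_nonpos.mpr (not_lt.mp h))]
            simp)
      have hp' := mul_le_mul_of_nonneg_left hp hα0.le
      have hn' := mul_le_mul_of_nonneg_left hn (sub_nonneg.mpr hα1.le)
      refine le_trans (le_of_eq ?_) (add_le_add hp' hn')
      simp only [Pi.add_apply, Pi.sub_apply]
      rw [mul_add, mul_add, add_add_add_comm]
      congr 1
      simp only [Finset.mul_sum, ← Finset.sum_add_distrib]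
      exact Finset.sum_congr rfl fun k _ => by ring
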